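/- arXiv:1811.03041 — 6 statements merged into one kernel-verified Lean document; each statement's English description precedes it below -/
import Mathlib

section
/- Let f : ℝ → ℝ be such that (1+v²)·f(v)·√(M_*(v)) is integrable. Then m_*[f] = f (as functions on ℝ) if and only if there exist real numbers a, b, c with f(v) = (a + b·v + c·v²)·√(M_*(v)) for all v; that is, the null space of the linearized BGK operator L_*f = m_*[f] − f is span{√(M_*), v·√(M_*), v²·√(M_*)}. -/
open MeasureTheory Real

lemma bgk_int (b : ℝ) (hb : 0 < b) (n : ℕ) :
    Integrable (fun x : ℝ => x ^ n * Real.exp (-b * x ^ 2)) := by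
  have := integrable_rpow_mul_exp_neg_mul_sq hb (s := (n : ℝ))
    (by have : (0:ℝ) ≤ n := Nat.cast_nonneg n
        linarith)
  simpa [Real.rpow_natCast] using this

lemma bgk_deriv (b : ℝ) (n : ℕ) (x : ℝ) :
    HasDerivAt (fun x : ℝ => x ^ n * Real.exp (-b * x ^ 2))
      (n * (x ^ (n - 1) * Real.exp (-b * x ^ 2))
        - 2 * b * (x ^ (n + 1) * Real.exp (-b * x ^ 2))) x := by
  have h1 := hasDerivAt_pow n x
  have h2 := (((hasDerivAt_pow 2 x).const_mul (-b)).exp)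
  refine (h1.mul h2).congr_deriv ?_
  simp only [Nat.cast_ofNat]
  ring

lemma bgk_rec (b : ℝ) (hb : 0 < b) (n : ℕ) :
    2 * b * ∫ x : ℝ, x ^ (n + 1) * Real.exp (-b * x ^ 2)
      = n * ∫ x : ℝ, x ^ (n - 1) * Real.exp (-b * x ^ 2) := by
  have i1 := (bgk_int b hb (n - 1)).const_mul (n : ℝ)
  have i2 := (bgk_int b hb (n + 1)).const_mul (2 * b)
  have h := integral_eq_zero_of_hasDerivAt_of_integrable (bgk_deriv b n) (i1.sub i2)
    (bgk_int b hb n)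
  rw [integral_sub i1 i2, integral_const_mul, integral_const_mul] at h
  linarith

lemma bgk_poly (ρ u T : ℝ) (hT : 0 < T) (e0 e1 e2 e3 e4 : ℝ) :
    ∫ v : ℝ, (e0 + e1 * (v - u) + e2 * (v - u) ^ 2 + e3 * (v - u) ^ 3 + e4 * (v - u) ^ 4) *
      (ρ / Real.sqrt (2 * Real.pi * T) * Real.exp (-(v - u) ^ 2 / (2 * T)))
      = ρ * (e0 + e2 * T + 3 * e4 * T ^ 2) := by
  rw [integral_sub_right_eq_self (fun w : ℝ => (e0 + e1 * w + e2 * w ^ 2 + e3 * w ^ 3 + e4 * w ^ 4) *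
      (ρ / Real.sqrt (2 * Real.pi * T) * Real.exp (-w ^ 2 / (2 * T)))) u]
  have hb : 0 < 1 / (2 * T) := by positivity
  obtain ⟨b, hbd⟩ : ∃ b, b = 1 / (2 * T) := ⟨_, rfl⟩
  rw [← hbd] at hb
  have hbT : 2 * b * T = 1 := by rw [hbd]; field_simp
  have j0 : ∫ x : ℝ, x ^ 0 * Real.exp (-b * x ^ 2) = Real.sqrt (2 * Real.pi * T) := by
    simp only [pow_zero, one_mul]
    rw [integral_gaussian, hbd]
    congr 1
    field_simp
  have r0 := bgk_rec b hb 0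
  have r1 := bgk_rec b hb 1
  have r2 := bgk_rec b hb 2
  have r3 := bgk_rec b hb 3
  norm_num only [Nat.reduceAdd, Nat.reduceSub] at r0 r1 r2 r3
  have k (n : ℕ) := bgk_int b hb n
  have e : ∀ w : ℝ, (e0 + e1 * w + e2 * w ^ 2 + e3 * w ^ 3 + e4 * w ^ 4) *
      (ρ / Real.sqrt (2 * Real.pi * T) * Real.exp (-w ^ 2 / (2 * T)))
      = ρ / Real.sqrt (2 * Real.pi * T) * (e0 * (w ^ 0 * Real.exp (-b * w ^ 2))
        + e1 * (w ^ 1 * Real.exp (-b * w ^ 2)) + e2 * (w ^ 2 * Real.exp (-b * w ^ 2))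
        + e3 * (w ^ 3 * Real.exp (-b * w ^ 2)) + e4 * (w ^ 4 * Real.exp (-b * w ^ 2))) := by
    intro w
    have : -w ^ 2 / (2 * T) = -b * w ^ 2 := by rw [hbd]; ring
    rw [this]; ring
  simp_rw [e]
  have c0 := (k 0).const_mul e0
  have c1 := (k 1).const_mul e1
  have c2 := (k 2).const_mul e2
  have c3 := (k 3).const_mul e3
  have c4 := (k 4).const_mul e4
  rw [integral_const_mul, integral_add (by fun_prop) c4,
    integral_add (by fun_prop) c3, integral_add (by fun_prop) c2, integral_add c0 c1]
  simp only [integral_const_mul]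
  rw [j0]
  rw [j0] at r1
  generalize (∫ x : ℝ, x ^ 1 * Real.exp (-b * x ^ 2)) = J1 at *
  generalize (∫ x : ℝ, x ^ 2 * Real.exp (-b * x ^ 2)) = J2 at *
  generalize (∫ x : ℝ, x ^ 3 * Real.exp (-b * x ^ 2)) = J3 at *
  generalize (∫ x : ℝ, x ^ 4 * Real.exp (-b * x ^ 2)) = J4 at *
  have hs : 0 < Real.sqrt (2 * Real.pi * T) := by positivity
  generalize Real.sqrt (2 * Real.pi * T) = S at *
  have q1 : J1 = 0 := by linear_combination T * r0 - J1 * hbT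
  have q2 : J2 = T * S := by linear_combination T * r1 - J2 * hbT
  have q3 : J3 = 0 := by linear_combination T * r2 - J3 * hbT + 2 * T * q1
  have q4 : J4 = 3 * T ^ 2 * S := by linear_combination T * r3 - J4 * hbT + 3 * T * q2
  rw [q1, q2, q3, q4]
  field_simp
  ring

/-- The null space of the linearized BGK operator L_* f = m_*[f] − f is
span{√M_*, v√M_*, v²√M_*}: we have m_*[f] = f iff f(v) = (a + b v + c v²)√(M_*(v)). -/
theorem nullspace_linearized_bgk
    (ρs us Ts : ℝ) (hρ : 0 < ρs) (hT : 0 < Ts)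
    (M : ℝ → ℝ)
    (hM : ∀ v, M v = ρs / Real.sqrt (2 * Real.pi * Ts) * Real.exp (-(v - us) ^ 2 / (2 * Ts)))
    (f : ℝ → ℝ)
    (hInt : Integrable (fun v => (1 + v ^ 2) * f v * Real.sqrt (M v)))
    (ρt ut Tt : ℝ)
    (h0 : ∫ v, f v * Real.sqrt (M v) = ρt)
    (h1 : ∫ v, v * f v * Real.sqrt (M v) = ρt * us + ρs * ut)
    (h2 : ∫ v, v ^ 2 * f v * Real.sqrt (M v)
        = ρt * (us ^ 2 + Ts) + 2 * ρs * us * ut + ρs * Tt)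
    (m : ℝ → ℝ)
    (hm : ∀ v, m v = (ρt / ρs + ut / Ts * (v - us)
        + Tt / (2 * Ts) * ((v - us) ^ 2 / Ts - 1)) * Real.sqrt (M v)) :
    m = f ↔ ∃ a b c : ℝ, ∀ v, f v = (a + b * v + c * v ^ 2) * Real.sqrt (M v) := by
  constructor
  · rintro rfl
    refine ⟨ρt / ρs - ut / Ts * us + Tt / (2 * Ts) * (us ^ 2 / Ts - 1),
      ut / Ts - Tt / (2 * Ts) * (2 * us / Ts), Tt / (2 * Ts) / Ts, fun v => ?_⟩
    rw [hm]
    ring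
  · rintro ⟨a, b, c, hf⟩
    have hMn : ∀ v, Real.sqrt (M v) * Real.sqrt (M v) = M v := fun v =>
      Real.mul_self_sqrt (by rw [hM]; positivity)
    -- coefficients centred at us
    obtain ⟨α, hα⟩ : ∃ α, α = a + b * us + c * us ^ 2 := ⟨_, rfl⟩
    obtain ⟨β, hβ⟩ : ∃ β, β = b + 2 * c * us := ⟨_, rfl⟩
    have hf' : ∀ v, f v = (α + β * (v - us) + c * (v - us) ^ 2) * Real.sqrt (M v) := by
      intro v; rw [hf, hα, hβ]; ring
    have g0 := bgk_poly ρs us Ts hT α β c 0 0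
    have g1 := bgk_poly ρs us Ts hT (us * α) (us * β + α) (us * c + β) c 0
    have g2 := bgk_poly ρs us Ts hT (us ^ 2 * α) (us ^ 2 * β + 2 * us * α)
      (us ^ 2 * c + 2 * us * β + α) (2 * us * c + β) c
    have s0 : ρt = ρs * (α + c * Ts + 3 * 0 * Ts ^ 2) := by
      rw [← h0, ← g0]
      congr 1; funext v
      rw [← hM, hf']
      linear_combination ((α + β * (v - us) + c * (v - us) ^ 2)) * hMn v
    have s1 : ρt * us + ρs * ut = ρs * (us * α + (us * c + β) * Ts + 3 * 0 * Ts ^ 2) := by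
      rw [← h1]
      refine Eq.trans ?_ g1
      congr 1; funext v
      rw [← hM, hf']
      linear_combination (v * (α + β * (v - us) + c * (v - us) ^ 2)) * hMn v
    have s2 : ρt * (us ^ 2 + Ts) + 2 * ρs * us * ut + ρs * Tt
        = ρs * (us ^ 2 * α + (us ^ 2 * c + 2 * us * β + α) * Ts + 3 * c * Ts ^ 2) := by
      rw [← h2]
      refine Eq.trans ?_ g2
      congr 1; funext v
      rw [← hM, hf']
      linear_combination (v ^ 2 * (α + β * (v - us) + c * (v - us) ^ 2)) * hMn v
    have t1 : ut = β * Ts := by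
      apply mul_left_cancel₀ hρ.ne'
      linear_combination s1 - us * s0
    have t2 : Tt = 2 * c * Ts ^ 2 := by
      apply mul_left_cancel₀ hρ.ne'
      linear_combination s2 - (us ^ 2 + Ts) * s0 - 2 * ρs * us * t1
    funext v
    rw [hm, hf', s0, t1, t2]
    congr 1
    field_simp
    ring
end

section
/- The functions χ_0, χ_+, χ_− diagonalize the multiplication-by-v operator restricted to their span: ∫ v·χ_i(v)·χ_j(v) dv = u_i·δ_{ij} for all i, j ∈ {0, +, −}, where u_0 = u_*, u_+ = u_* + √(3T_*), and u_− = u_* − √(3T_*). -/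
open MeasureTheory Real

lemma aux_int (T : ℝ) (hT : 0 < T) (n : ℕ) :
    Integrable (fun x : ℝ => x ^ n * Real.exp (-x ^ 2 / (2 * T))) := by
  have h := integrable_rpow_mul_exp_neg_mul_sq (b := 1 / (2 * T)) (by positivity)
    (s := (n : ℝ)) (by have : (0 : ℝ) ≤ n := Nat.cast_nonneg n
                       linarith)
  refine h.congr (Filter.Eventually.of_forall fun x => ?_)
  simp only [Real.rpow_natCast]
  congr 2
  ring

lemma aux_deriv (T x : ℝ) :
    HasDerivAt (fun x : ℝ => Real.exp (-x ^ 2 / (2 * T)))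
      (-(1 / T) * (x ^ 1 * Real.exp (-x ^ 2 / (2 * T)))) x := by
  have h := (((hasDerivAt_pow 2 x).neg).div_const (2 * T)).exp
  refine h.congr_deriv ?_
  simp only [Pi.neg_apply]
  by_cases hT : T = 0
  · simp [hT]
  · push_cast
    field_simp

lemma aux_m1 (T : ℝ) (hT : 0 < T) :
    ∫ x : ℝ, x ^ 1 * Real.exp (-x ^ 2 / (2 * T)) = 0 := by
  have h := integral_eq_zero_of_hasDerivAt_of_integrable (aux_deriv T)
    ((aux_int T hT 1).const_mul _) (by simpa using aux_int T hT 0)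
  rw [integral_const_mul] at h
  have : -(1 / T) ≠ 0 := by
    have : 0 < 1 / T := by positivity
    linarith
  exact (mul_eq_zero.mp h).resolve_left this

lemma aux_rec (T : ℝ) (hT : 0 < T) (n : ℕ) :
    ∫ x : ℝ, x ^ (n + 2) * Real.exp (-x ^ 2 / (2 * T))
      = T * (n + 1) * ∫ x : ℝ, x ^ n * Real.exp (-x ^ 2 / (2 * T)) := by
  have hd : ∀ x : ℝ, HasDerivAt (fun x : ℝ => x ^ (n + 1) * Real.exp (-x ^ 2 / (2 * T)))
      ((n + 1 : ℝ) * (x ^ n * Real.exp (-x ^ 2 / (2 * T)))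
        - 1 / T * (x ^ (n + 2) * Real.exp (-x ^ 2 / (2 * T)))) x := by
    intro x
    refine ((hasDerivAt_pow (n + 1) x).mul (aux_deriv T x)).congr_deriv ?_
    simp only [Nat.add_sub_cancel]
    push_cast
    ring
  have h := integral_eq_zero_of_hasDerivAt_of_integrable hd
    (((aux_int T hT n).const_mul _).sub ((aux_int T hT (n + 2)).const_mul _)) (aux_int T hT (n + 1))
  rw [integral_sub ((aux_int T hT n).const_mul _) ((aux_int T hT (n + 2)).const_mul _),
    integral_const_mul, integral_const_mul] at h
  generalize (∫ x : ℝ, x ^ (n + 2) * Real.exp (-x ^ 2 / (2 * T))) = A at h ⊢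
  generalize (∫ x : ℝ, x ^ n * Real.exp (-x ^ 2 / (2 * T))) = B at h ⊢
  field_simp at h
  linarith

lemma aux_m0 (T : ℝ) :
    ∫ x : ℝ, x ^ 0 * Real.exp (-x ^ 2 / (2 * T)) = √(2 * π * T) := by
  have h := integral_gaussian (1 / (2 * T))
  rw [show π / (1 / (2 * T)) = 2 * π * T by rw [div_div_eq_mul_div]; ring] at h
  rw [← h]
  congr 1
  ext x
  rw [pow_zero, one_mul]
  congr 1
  ring

lemma aux_poly (T u : ℝ) (hT : 0 < T) (a : Fin 6 → ℝ) :
    ∫ v : ℝ, (∑ k, a k * ((v - u) ^ (k : ℕ) * Real.exp (-(v - u) ^ 2 / (2 * T))))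
      = (a 0 + a 2 * T + 3 * a 4 * T ^ 2) * √(2 * π * T) := by
  rw [integral_sub_right_eq_self
    (fun x : ℝ => ∑ k, a k * (x ^ (k : ℕ) * Real.exp (-x ^ 2 / (2 * T)))) u]
  rw [integral_finsetSum _ (fun (k : Fin 6) _ => (aux_int T hT (k : ℕ)).const_mul (a k))]
  simp only [integral_const_mul]
  have e0 := aux_m0 T
  have e1 := aux_m1 T hT
  have e2 := aux_rec T hT 0
  have e3 := aux_rec T hT 1
  have e4 := aux_rec T hT 2
  have e5 := aux_rec T hT 3
  norm_num only [e0, e1, Nat.reduceAdd] at e2 e3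
  norm_num only [e2, e3, Nat.reduceAdd] at e4 e5
  rw [Fin.sum_univ_six]
  change a 0 * (∫ x : ℝ, x ^ 0 * _) + a 1 * (∫ x : ℝ, x ^ 1 * _) + a 2 * (∫ x : ℝ, x ^ 2 * _)
    + a 3 * (∫ x : ℝ, x ^ 3 * _) + a 4 * (∫ x : ℝ, x ^ 4 * _) + a 5 * (∫ x : ℝ, x ^ 5 * _) = _
  rw [e0, e1, e2, e3, e4, e5]
  push_cast
  ring

lemma aux_main (ρs us Ts : ℝ) (hρ : 0 < ρs) (hT : 0 < Ts) (M f g : ℝ → ℝ)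
    (hM : ∀ v, M v = ρs / Real.sqrt (2 * Real.pi * Ts) * Real.exp (-(v - us) ^ 2 / (2 * Ts)))
    (α β γ α' β' γ' : ℝ)
    (hf : ∀ v, f v = 1 / √(6 * ρs) * (α + β * (√(3 / Ts) * (v - us)) + γ * ((v - us) ^ 2 / Ts))
      * √(M v))
    (hg : ∀ v, g v = 1 / √(6 * ρs) * (α' + β' * (√(3 / Ts) * (v - us)) + γ' * ((v - us) ^ 2 / Ts))
      * √(M v)) :
    ∫ v, v * f v * g v = 1 / 6 * (us * (α * α' + 3 * β * β' + α * γ' + γ * α' + 3 * γ * γ')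
      + √(3 * Ts) * (α * β' + β * α' + 3 * (β * γ' + γ * β'))) := by
  have hs : √(3 * Ts) = √(3 / Ts) * Ts := by
    rw [Real.sqrt_eq_iff_mul_self_eq (by positivity) (by positivity)]
    symm
    have := Real.mul_self_sqrt (show 0 ≤ 3 / Ts by positivity)
    calc _ = (√(3 / Ts) * √(3 / Ts)) * (Ts * Ts) := by ring
      _ = _ := by rw [this]; field_simp
  rw [hs]
  have hs2 : √(3 / Ts) ^ 2 = 3 / Ts := Real.sq_sqrt (by positivity)
  generalize √(3 / Ts) = s at *
  have hZ : 0 < √(2 * π * Ts) := by positivity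
  have hp := aux_poly Ts us hT (fun k => 1 / (6 * √(2 * π * Ts)) * (![us * (α * α'),
    us * s * (α * β' + β * α') + α * α',
    us * (β * β' * (3 / Ts) + (α * γ' + γ * α') / Ts) + s * (α * β' + β * α'),
    us * s * (β * γ' + γ * β') / Ts + (β * β' * (3 / Ts) + (α * γ' + γ * α') / Ts),
    us * (γ * γ') / Ts ^ 2 + s * (β * γ' + γ * β') / Ts,
    γ * γ' / Ts ^ 2] : Fin 6 → ℝ) k)
  generalize √(2 * π * Ts) = Z at *
  have key : ∀ v, v * f v * g v = _ := fun v => by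
    have hMn : 0 ≤ M v := by rw [hM]; positivity
    have h6 := Real.sq_sqrt (show 0 ≤ 6 * ρs by positivity)
    have hMs := Real.sq_sqrt hMn
    calc v * f v * g v = v * (1 / √(6 * ρs) ^ 2) *
        (α + β * (s * (v - us)) + γ * ((v - us) ^ 2 / Ts)) *
        (α' + β' * (s * (v - us)) + γ' * ((v - us) ^ 2 / Ts)) * √(M v) ^ 2 := by
          rw [hf, hg]; ring
      _ = 1 / (6 * Z) * (v * (α + β * (s * (v - us)) + γ * ((v - us) ^ 2 / Ts)) *
        (α' + β' * (s * (v - us)) + γ' * ((v - us) ^ 2 / Ts))) *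
          Real.exp (-(v - us) ^ 2 / (2 * Ts)) := by
          rw [h6, hMs, hM]; field_simp
  simp only [key]
  refine Eq.trans (integral_congr_ae (Filter.Eventually.of_forall fun v => ?_)) (hp.trans ?_)
  · simp only [Fin.sum_univ_six]
    generalize Real.exp (-(v - us) ^ 2 / (2 * Ts)) = E
    simp
    rw [← hs2]
    ring
  · simp
    field_simp
    ring


/-- The functions χ_0, χ_+, χ_− diagonalize multiplication by v on their span:
∫ v χ_i χ_j dv = u_i δ_{ij} with u_0 = u_*, u_± = u_* ± √(3T_*).
Here χ 0 = χ_0, χ 1 = χ_+, χ 2 = χ_−. -/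
theorem chi_diagonalize_multiplication
    (ρs us Ts : ℝ) (hρ : 0 < ρs) (hT : 0 < Ts)
    (M : ℝ → ℝ)
    (hM : ∀ v, M v = ρs / Real.sqrt (2 * Real.pi * Ts) * Real.exp (-(v - us) ^ 2 / (2 * Ts)))
    (χ : Fin 3 → ℝ → ℝ)
    (h0 : ∀ v, χ 0 v = 1 / Real.sqrt (6 * ρs) * ((v - us) ^ 2 / Ts - 3) * Real.sqrt (M v))
    (h1 : ∀ v, χ 1 v = 1 / Real.sqrt (6 * ρs)
        * (Real.sqrt (3 / Ts) * (v - us) + (v - us) ^ 2 / Ts) * Real.sqrt (M v))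
    (h2 : ∀ v, χ 2 v = 1 / Real.sqrt (6 * ρs)
        * (Real.sqrt (3 / Ts) * (v - us) - (v - us) ^ 2 / Ts) * Real.sqrt (M v)) :
    ∀ i j : Fin 3, ∫ v, v * χ i v * χ j v =
      if i = j then ![us, us + Real.sqrt (3 * Ts), us - Real.sqrt (3 * Ts)] i else 0 := by
  have c0 : ∀ v, χ 0 v = 1 / √(6 * ρs) * ((-3) + 0 * (√(3 / Ts) * (v - us)) + 1 * ((v - us) ^ 2 / Ts))
      * √(M v) := fun v => by rw [h0]; ring
  have c1 : ∀ v, χ 1 v = 1 / √(6 * ρs) * (0 + 1 * (√(3 / Ts) * (v - us)) + 1 * ((v - us) ^ 2 / Ts))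
      * √(M v) := fun v => by rw [h1]; ring
  have c2 : ∀ v, χ 2 v = 1 / √(6 * ρs) * (0 + 1 * (√(3 / Ts) * (v - us)) + (-1) * ((v - us) ^ 2 / Ts))
      * √(M v) := fun v => by rw [h2]; ring
  have A := fun f g => aux_main ρs us Ts hρ hT M f g hM
  intro i j
  fin_cases i <;> fin_cases j <;> simp only [Fin.zero_eta, Fin.mk_one, Fin.reduceFinMk]
  · rw [A _ _ _ _ _ _ _ _ c0 c0]; simp; ring
  · rw [A _ _ _ _ _ _ _ _ c0 c1]; simp
  · rw [A _ _ _ _ _ _ _ _ c0 c2]; simp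
  · rw [A _ _ _ _ _ _ _ _ c1 c0]; simp
  · rw [A _ _ _ _ _ _ _ _ c1 c1]; simp; ring
  · rw [A _ _ _ _ _ _ _ _ c1 c2]; simp
  · rw [A _ _ _ _ _ _ _ _ c2 c0]; simp
  · rw [A _ _ _ _ _ _ _ _ c2 c1]; simp
  · rw [A _ _ _ _ _ _ _ _ c2 c2]; simp; ring
end

section
/- For every n ≥ 0, the recurrence coefficients of the half-space Hermite polynomials satisfy β_{n+1} = 2Tn + T − β_n + u·α_n − α_n². -/
open MeasureTheory Polynomial

lemma hh_integrable (u T : ℝ) (hT : 0 < T) (p : ℝ[X]) :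
    Integrable (fun v : ℝ => p.eval v * Real.exp (-(v - u) ^ 2 / (2 * T))) := by
  have key : ∀ q : ℝ[X], Integrable (fun v : ℝ => q.eval v * Real.exp (-(1 / (2 * T)) * v ^ 2)) := by
    intro q
    induction q using Polynomial.induction_on' with
    | add p q hp hq =>
      refine (hp.add hq).congr (Filter.Eventually.of_forall fun v => ?_)
      simp [add_mul]
    | monomial k a =>
      have h := (integrable_rpow_mul_exp_neg_mul_sq (b := 1 / (2 * T)) (by positivity)
        (s := (k : ℝ)) (by have : (0:ℝ) ≤ k := k.cast_nonneg
                           linarith)).const_mul a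
      refine h.congr (Filter.Eventually.of_forall fun v => ?_)
      simp [mul_assoc]
  have h := (key (p.comp (X + C u))).comp_sub_right u
  refine h.congr (Filter.Eventually.of_forall fun v => ?_)
  simp only [eval_comp, eval_add, eval_X, eval_C, sub_add_cancel]
  congr 2
  ring

lemma hh_functional (u T : ℝ) (hT : 0 < T) : ∃ L : ℝ[X] →ₗ[ℝ] ℝ,
    (∀ p : ℝ[X], L p = ∫ v in Set.Ioi (0 : ℝ), p.eval v * Real.exp (-(v - u) ^ 2 / (2 * T))) ∧
    (∀ p : ℝ[X], p.eval 0 = 0 → T * L (derivative p) = L ((X - C u) * p)) := by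
  refine ⟨{ toFun := fun p => ∫ v in Set.Ioi (0 : ℝ), p.eval v * Real.exp (-(v - u) ^ 2 / (2 * T))
            map_add' := ?_
            map_smul' := ?_ }, fun _ => rfl, ?_⟩
  · intro p q
    rw [← integral_add (hh_integrable u T hT p).integrableOn (hh_integrable u T hT q).integrableOn]
    simp [add_mul]
  · intro a p
    simp [mul_assoc, integral_const_mul]
  · intro p hp
    simp only [LinearMap.coe_mk, AddHom.coe_mk]
    have hd : ∀ v : ℝ, HasDerivAt (fun v : ℝ => p.eval v * Real.exp (-(v - u) ^ 2 / (2 * T)))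
        ((derivative p - C (1 / T) * ((X - C u) * p)).eval v *
          Real.exp (-(v - u) ^ 2 / (2 * T))) v := by
      intro v
      have h1 : HasDerivAt (fun v : ℝ => -(v - u) ^ 2 / (2 * T)) (-(v - u) / T) v := by
        have := ((((hasDerivAt_id v).sub_const u).pow 2).neg).div_const (2 * T)
        refine this.congr_deriv ?_
        simp
        field_simp
        ring
      have := (p.hasDerivAt v).mul h1.exp
      refine this.congr_deriv ?_
      simp only [eval_sub, eval_mul, eval_C, eval_X]
      ring
    have hi := fun q : ℝ[X] => (hh_integrable u T hT q).integrableOn (s := Set.Ioi 0)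
    have ht := tendsto_zero_of_hasDerivAt_of_integrableOn_Ioi (a := 0) (fun v _ => hd v) (hi _) (hi _)
    have := integral_Ioi_of_hasDerivAt_of_tendsto' (a := 0) (fun v _ => hd v) (hi _) ht
    simp only [hp, zero_mul, sub_zero] at this
    have e : (fun v : ℝ => (derivative p - C (1 / T) * ((X - C u) * p)).eval v *
          Real.exp (-(v - u) ^ 2 / (2 * T))) = fun v => (derivative p).eval v *
          Real.exp (-(v - u) ^ 2 / (2 * T)) - (1 / T) * (((X - C u) * p).eval v *
          Real.exp (-(v - u) ^ 2 / (2 * T))) := by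
      ext v; simp; ring
    rw [e, integral_sub (hi _) ((hi _).const_mul _), integral_const_mul] at this
    have h2 := sub_eq_zero.1 this
    rw [h2, ← mul_assoc, mul_one_div_cancel hT.ne', one_mul]

lemma hh_low (L : ℝ[X] →ₗ[ℝ] ℝ) (B : ℕ → ℝ[X]) (hdeg : ∀ n, (B n).natDegree = n)
    (hlead : ∀ n, 0 < (B n).leadingCoeff)
    (ho : ∀ m n, L (B m * B n) = if m = n then 1 else 0) :
    ∀ m : ℕ, ∀ p : ℝ[X], p.degree < m → ∀ n, m ≤ n → L (p * B n) = 0 := by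
  intro m
  induction m with
  | zero =>
    intro p hp n _
    have : p = 0 := by simpa using hp
    simp [this]
  | succ m ih =>
    intro p hp n hn
    have hm := hlead m
    rw [leadingCoeff, hdeg] at hm
    have hq : (p - C (p.coeff m / (B m).coeff m) * B m).degree < m := by
      rw [degree_lt_iff_coeff_zero] at hp ⊢
      intro k hk
      rcases hk.eq_or_lt with rfl | hk
      · simp; field_simp; simp
      · have : (B m).coeff k = 0 := coeff_eq_zero_of_natDegree_lt (by rw [hdeg]; exact hk)
        simp [this, hp k hk]
    have h := ih _ hq n (by omega)
    rw [sub_mul, map_sub, mul_assoc, ← smul_eq_C_mul, map_smul, ho, if_neg (by omega)] at h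
    simpa using h

/-- Recurrence for the β-coefficients of the half-space Hermite polynomials:
β_{n+1} = 2Tn + T − β_n + u·α_n − α_n². -/
theorem halfspace_hermite_beta_recurrence
    (u T : ℝ) (hT : 0 < T)
    (w : ℝ → ℝ) (hw : ∀ v, w v = Real.exp (-(v - u) ^ 2 / (2 * T)))
    (B : ℕ → Polynomial ℝ)
    (hdeg : ∀ n, (B n).natDegree = n)
    (hlead : ∀ n, 0 < (B n).leadingCoeff)
    (horth : ∀ m n, ∫ v in Set.Ioi (0 : ℝ), (B m).eval v * (B n).eval v * w v
        = if m = n then 1 else 0)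
    (α : ℕ → ℝ)
    (hα : ∀ n, α n = ∫ v in Set.Ioi (0 : ℝ), v * (B n).eval v ^ 2 * w v)
    (c : ℕ → ℝ) (hc0 : c 0 = 0)
    (hc : ∀ n, c (n + 1) = ∫ v in Set.Ioi (0 : ℝ), v * (B n).eval v * (B (n + 1)).eval v * w v)
    (β : ℕ → ℝ) (hβ : ∀ n, β n = c n ^ 2)
    (hrec : ∀ n, ∀ v : ℝ, c (n + 1) * (B (n + 1)).eval v
        = (v - α n) * (B n).eval v - c n * (B (n - 1)).eval v)
    (hcpos : ∀ n, 1 ≤ n → 0 < c n) :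
    ∀ n : ℕ, β (n + 1) = 2 * T * n + T - β n + u * α n - α n ^ 2 := by
  intro n
  obtain ⟨L, hL, hD⟩ := hh_functional u T hT
  have ho : ∀ m n, L (B m * B n) = if m = n then 1 else 0 := by
    intro m n
    rw [hL, ← horth m n]
    simp [hw]
  have ha : L (X * (B n * B n)) = α n := by
    rw [hL, hα]
    simp [hw, pow_two]
  have hlow := hh_low L B hdeg hlead ho
  have hR : (X - C (α n)) * B n = C (c (n + 1)) * B (n + 1) + C (c n) * B (n - 1) := by
    apply Polynomial.funext
    intro v
    have := hrec n v
    simp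
    linarith
  have hsq : L (((X - C (α n)) * B n) * ((X - C (α n)) * B n)) = c (n + 1) ^ 2 + c n ^ 2 := by
    rw [hR]
    have e : (C (c (n + 1)) * B (n + 1) + C (c n) * B (n - 1)) *
        (C (c (n + 1)) * B (n + 1) + C (c n) * B (n - 1)) =
        (c (n + 1) ^ 2) • (B (n + 1) * B (n + 1)) + (2 * c (n + 1) * c n) • (B (n + 1) * B (n - 1))
        + (c n ^ 2) • (B (n - 1) * B (n - 1)) := by
      simp only [smul_eq_C_mul, map_mul, map_pow, map_ofNat]
      ring
    rw [e]
    simp only [map_add, map_smul, ho]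
    rw [if_neg (by omega : n + 1 ≠ n - 1)]
    simp
  have e2 : ((X - C (α n)) * B n) * ((X - C (α n)) * B n) = X * X * (B n * B n)
      - (2 * α n) • (X * (B n * B n)) + (α n ^ 2) • (B n * B n) := by
    simp only [smul_eq_C_mul, map_mul, map_pow, map_ofNat]
    ring
  have hnn : L (B n * B n) = 1 := by simp [ho]
  rw [e2] at hsq
  simp only [map_add, map_sub, map_smul, ha, hnn, smul_eq_mul] at hsq
  have hder : L ((X * derivative (B n)) * B n) = n := by
    have hq : (X * derivative (B n) - C (n : ℝ) * B n).degree < (n : WithBot ℕ) := by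
      rw [degree_lt_iff_coeff_zero]
      intro k hk
      rcases k with _ | k
      · obtain rfl : n = 0 := by omega
        simp
      · rw [coeff_sub, coeff_X_mul, coeff_derivative, coeff_C_mul]
        rcases hk.eq_or_lt with h | h
        · rw [h]; push_cast; ring
        · rw [coeff_eq_zero_of_natDegree_lt (by rw [hdeg]; exact h)]; simp
    have h := hlow n _ hq n le_rfl
    rw [sub_mul, map_sub, mul_assoc (C _), ← smul_eq_C_mul, map_smul, hnn] at h
    simp at h
    linarith
  have hI := hD (X * (B n * B n)) (by simp)
  have e3 : derivative (X * (B n * B n)) = B n * B n + (2 : ℝ) • ((X * derivative (B n)) * B n) := by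
    simp only [derivative_mul, derivative_X, smul_eq_C_mul, map_ofNat]
    ring
  have e4 : (X - C u) * (X * (B n * B n)) = X * X * (B n * B n) - u • (X * (B n * B n)) := by
    simp only [smul_eq_C_mul]
    ring
  rw [e3, e4] at hI
  simp only [map_add, map_sub, map_smul, ha, hnn, hder, smul_eq_mul] at hI
  rw [hβ, hβ]
  linarith
end

section
/- For every n ≥ 0, the recurrence coefficients of the half-space Hermite polynomials satisfy α_{n+1} = (T/β_{n+1})·(α_0 + α_1 + ⋯ + α_n) − α_n + u. -/
open MeasureTheory Polynomial

theorem hh_int (u T : ℝ) (hT : 0 < T) (p : Polynomial ℝ) :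
    Integrable (fun v : ℝ => p.eval v * Real.exp (-(v - u) ^ 2 / (2 * T))) := by
  have key : ∀ q : Polynomial ℝ,
      Integrable (fun v : ℝ => q.eval v * Real.exp (-(1 / (2 * T)) * v ^ 2)) := by
    intro q
    induction q using Polynomial.induction_on' with
    | add p q hp hq =>
      refine (hp.add hq).congr (Filter.Eventually.of_forall fun v => ?_)
      simp [add_mul]
    | monomial n a =>
      have hb : 0 < 1 / (2 * T) := by positivity
      have h := (integrable_rpow_mul_exp_neg_mul_sq hb (s := (n : ℝ))
        (by have : (0 : ℝ) ≤ n := Nat.cast_nonneg n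
            linarith)).const_mul a
      refine h.congr (Filter.Eventually.of_forall fun v => ?_)
      simp [Real.rpow_natCast, mul_assoc]
  have h := (key (p.comp (X + C u))).comp_sub_right u
  refine h.congr (Filter.Eventually.of_forall fun v => ?_)
  simp only [eval_comp, eval_add, eval_X, eval_C, sub_add_cancel]
  congr 2
  field_simp

theorem hh_ibp (u T : ℝ) (hT : 0 < T) (p : Polynomial ℝ) :
    ∫ v in Set.Ioi (0 : ℝ), (derivative (X * p) - C (1 / T) * ((X - C u) * (X * p))).eval v
      * Real.exp (-(v - u) ^ 2 / (2 * T)) = 0 := by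
  have hd : ∀ v : ℝ, HasDerivAt (fun v => (X * p).eval v * Real.exp (-(v - u) ^ 2 / (2 * T)))
      ((derivative (X * p) - C (1 / T) * ((X - C u) * (X * p))).eval v
      * Real.exp (-(v - u) ^ 2 / (2 * T))) v := by
    intro v
    have h1 := (X * p).hasDerivAt v
    have h2 : HasDerivAt (fun v : ℝ => -(v - u) ^ 2 / (2 * T)) (-(v - u) / T) v := by
      have h3 := ((((hasDerivAt_id v).sub_const u).pow 2).neg).div_const (2 * T)
      refine HasDerivAt.congr_deriv (f' := _) h3 ?_
      simp
      field_simp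
      ring
    refine HasDerivAt.congr_deriv (h1.mul h2.exp) ?_
    simp only [eval_sub, eval_mul, eval_C, eval_X]
    ring
  have hf := hh_int u T hT (X * p)
  have hf' := hh_int u T hT (derivative (X * p) - C (1 / T) * ((X - C u) * (X * p)))
  have ht := tendsto_zero_of_hasDerivAt_of_integrableOn_Ioi (a := (0 : ℝ)) (fun x _ => hd x)
    hf'.integrableOn hf.integrableOn
  have := integral_Ioi_of_hasDerivAt_of_tendsto' (a := (0 : ℝ)) (fun x _ => hd x)
    hf'.integrableOn ht
  rw [this]
  simp

/-- Recurrence for the α-coefficients of the half-space Hermite polynomials: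
α_{n+1} = (T/β_{n+1})·(α_0 + ⋯ + α_n) − α_n + u. -/
theorem halfspace_hermite_alpha_recurrence
    (u T : ℝ) (hT : 0 < T)
    (w : ℝ → ℝ) (hw : ∀ v, w v = Real.exp (-(v - u) ^ 2 / (2 * T)))
    (B : ℕ → Polynomial ℝ)
    (hdeg : ∀ n, (B n).natDegree = n)
    (hlead : ∀ n, 0 < (B n).leadingCoeff)
    (horth : ∀ m n, ∫ v in Set.Ioi (0 : ℝ), (B m).eval v * (B n).eval v * w v
        = if m = n then 1 else 0)
    (α : ℕ → ℝ)
    (hα : ∀ n, α n = ∫ v in Set.Ioi (0 : ℝ), v * (B n).eval v ^ 2 * w v)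
    (c : ℕ → ℝ) (hc0 : c 0 = 0)
    (hc : ∀ n, c (n + 1) = ∫ v in Set.Ioi (0 : ℝ), v * (B n).eval v * (B (n + 1)).eval v * w v)
    (β : ℕ → ℝ) (hβ : ∀ n, β n = c n ^ 2)
    (hrec : ∀ n, ∀ v : ℝ, c (n + 1) * (B (n + 1)).eval v
        = (v - α n) * (B n).eval v - c n * (B (n - 1)).eval v)
    (hcpos : ∀ n, 1 ≤ n → 0 < c n) :
    ∀ n : ℕ, α (n + 1) = T / β (n + 1) * (∑ k ∈ Finset.range (n + 1), α k) - α n + u := by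
  
  obtain rfl : w = fun v => Real.exp (-(v - u) ^ 2 / (2 * T)) := funext hw
  obtain ⟨L, hL⟩ : ∃ L : Polynomial ℝ →ₗ[ℝ] ℝ, ∀ p, L p =
      ∫ v in Set.Ioi (0 : ℝ), p.eval v * Real.exp (-(v - u) ^ 2 / (2 * T)) := by
    refine ⟨{ toFun := fun p =>
                ∫ v in Set.Ioi (0 : ℝ), p.eval v * Real.exp (-(v - u) ^ 2 / (2 * T))
              map_add' := ?_
              map_smul' := ?_ }, fun p => rfl⟩
    · intro p q
      rw [← integral_add (hh_int u T hT p).integrableOn (hh_int u T hT q).integrableOn]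
      simp [add_mul]
    · intro a p
      rw [RingHom.id_apply, smul_eq_mul, ← integral_const_mul]
      simp [mul_assoc]
  have hC : ∀ (a : ℝ) (p : Polynomial ℝ), L (C a * p) = a * L p := by
    intro a p
    rw [← smul_eq_C_mul, map_smul, smul_eq_mul]
  have hO : ∀ m n, L (B m * B n) = if m = n then 1 else 0 := by
    intro m n
    rw [hL, ← horth m n]
    simp
  have hA : ∀ n, L (X * B n * B n) = α n := by
    intro n
    rw [hL, hα]
    simp [pow_two, mul_assoc]
  have hcc : ∀ n, L (X * B n * B (n + 1)) = c (n + 1) := by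
    intro n
    rw [hL, hc]
    simp
  have hR : ∀ n, C (c (n + 1)) * B (n + 1) = (X - C (α n)) * B n - C (c n) * B (n - 1) := by
    intro n
    apply Polynomial.funext
    intro v
    simpa using hrec n v
  have hI : ∀ p, L (derivative (X * p)) = 1 / T * L ((X - C u) * (X * p)) := by
    intro p
    have h := hh_ibp u T hT p
    rw [← hL, map_sub, hC] at h
    linarith
  have hk : ∀ n, (B n).coeff n ≠ 0 := by
    intro n
    have h := hlead n
    rw [leadingCoeff, hdeg] at h
    exact h.ne'
  have hz : ∀ n j, n < j → (B n).coeff j = 0 := by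
    intro n j h
    exact coeff_eq_zero_of_natDegree_lt (by rw [hdeg]; exact h)
  have hP : ∀ n m, m ≤ n → ∀ q : Polynomial ℝ, (∀ j, m ≤ j → q.coeff j = 0) →
      L (B n * q) = 0 := by
    intro n m
    induction m with
    | zero =>
      intro _ q hq
      have : q = 0 := by
        ext j
        simpa using hq j (Nat.zero_le j)
      simp [this]
    | succ m ih =>
      intro hm q hq
      have h := ih (by omega) (q - C (q.coeff m / (B m).coeff m) * B m) (by
        intro j hj
        rw [coeff_sub, coeff_C_mul]
        rcases hj.eq_or_lt with rfl | hj
        · field_simp [hk m]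
          simp
        · rw [hq j hj, hz m j hj]
          simp)
      rw [mul_sub, map_sub, mul_left_comm, hC, hO, if_neg (by omega)] at h
      linarith
  have hkc : ∀ n, c (n + 1) * (B (n + 1)).coeff (n + 1) = (B n).coeff n := by
    intro n
    have h := congrArg (fun p => p.coeff (n + 1)) (hR n)
    simp only [coeff_C_mul, coeff_sub, sub_mul, coeff_X_mul] at h
    rw [h, hz n (n + 1) (by omega), hz (n - 1) (n + 1) (by omega)]
    ring
  have hs : ∀ n, (B (n + 1)).coeff n =
      -(∑ k ∈ Finset.range (n + 1), α k) * (B (n + 1)).coeff (n + 1) := by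
    intro n
    have hc1 := (hcpos (n + 1) (by omega)).ne'
    apply mul_left_cancel₀ hc1
    rw [mul_left_comm, hkc]
    induction n with
    | zero =>
      have h := congrArg (fun p => p.coeff 0) (hR 0)
      simp only [coeff_C_mul, coeff_sub, sub_mul, coeff_X_mul_zero, hc0] at h
      rw [h]
      simp
    | succ n ih =>
      have h := congrArg (fun p => p.coeff (n + 1)) (hR (n + 1))
      simp only [coeff_C_mul, coeff_sub, sub_mul, coeff_X_mul, Nat.add_sub_cancel] at h
      rw [hz n (n + 1) (by omega)] at h
      have hc2 := (hcpos (n + 1) (by omega)).ne'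
      have ih' := ih hc2
      rw [← hkc n, mul_left_comm] at ih'
      have ih2 := mul_left_cancel₀ hc2 ih'
      rw [h, ih2, Finset.sum_range_succ _ (n + 1)]
      ring
  intro n
  have hc1 := (hcpos (n + 1) (by omega)).ne'
  set S := ∑ k ∈ Finset.range (n + 1), α k with hS
  have hX : ∀ (p : Polynomial ℝ) (j : ℕ), (X * derivative p).coeff j = j * p.coeff j := by
    intro p j
    cases j with
    | zero => simp
    | succ j =>
      rw [coeff_X_mul, coeff_derivative]
      push_cast
      ring
  have e1 : L (B (n + 1) * (X * derivative (B n))) = 0 := by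
    apply hP (n + 1) (n + 1) le_rfl
    intro j hj
    rw [hX, hz n j (by omega), mul_zero]
  have e2 : L (B n * (X * derivative (B (n + 1)))) = S / c (n + 1) := by
    have h := hP n n le_rfl (X * derivative (B (n + 1)) - C ((n : ℝ) + 1) * B (n + 1)
      - C (S / c (n + 1)) * B n) (by
        intro j hj
        rw [coeff_sub, coeff_sub, coeff_C_mul, coeff_C_mul, hX]
        rcases hj.eq_or_lt with rfl | hj
        · rw [← hkc n, hs n, ← hS]
          field_simp
          ring
        · rw [hz n j hj]
          rcases (Nat.succ_le_of_lt hj).eq_or_lt with rfl | hj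
          · push_cast
            ring
          · rw [hz (n + 1) j hj]
            ring)
    rw [mul_sub, mul_sub, map_sub, map_sub, mul_left_comm _ (C _), mul_left_comm _ (C _), hC, hC,
      hO, hO, if_neg (by omega), if_pos rfl] at h
    linarith
  have e3 : c n * L (X * B (n - 1) * B (n + 1)) = 0 := by
    cases n with
    | zero => rw [hc0, zero_mul]
    | succ n =>
      rw [mul_comm (X * _), hP (n + 1 + 1) (n + 1 + 1) le_rfl, mul_zero]
      intro j hj
      obtain ⟨j, rfl⟩ : ∃ i, j = i + 1 := ⟨j - 1, by omega⟩
      rw [coeff_X_mul]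
      exact hz _ _ (by omega)
  have e4 : L (X * (X * B n * B (n + 1))) = c (n + 1) * α (n + 1) + α n * c (n + 1) := by
    have : X * (X * B n * B (n + 1)) = C (c (n + 1)) * (X * B (n + 1) * B (n + 1))
        + C (α n) * (X * B n * B (n + 1)) + C (c n) * (X * B (n - 1) * B (n + 1)) := by
      linear_combination (-X * B (n + 1)) * hR n
    rw [this, map_add, map_add, hC, hC, hC, hA, hcc, e3, add_zero]
  have e5 := hI (B n * B (n + 1))
  have e6 : derivative (X * (B n * B (n + 1))) = B n * B (n + 1)
      + B (n + 1) * (X * derivative (B n)) + B n * (X * derivative (B (n + 1))) := by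
    simp only [derivative_mul, derivative_X]
    ring
  rw [e6, map_add, map_add, e1, e2, hO, if_neg (by omega), sub_mul, map_sub, hC, ← mul_assoc X (B n),
    e4, hcc] at e5
  rw [hβ]
  field_simp at e5 ⊢
  linear_combination -e5
end

section
/- For every n ≥ 0, ∫₀^∞ v·B_n'(v)·B_n(v)·w(v) dv = n, where B_n' denotes the derivative of the polynomial B_n. -/
open MeasureTheory Polynomial

lemma aux_int0 (b : ℝ) (hb : 0 < b) (p : Polynomial ℝ) :
    Integrable (fun v : ℝ => p.eval v * Real.exp (-b * v ^ 2)) := by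
  induction p using Polynomial.induction_on' with
  | add p q hp hq =>
    simp only [eval_add, add_mul]
    exact hp.add hq
  | monomial k a =>
    have h := (integrable_rpow_mul_exp_neg_mul_sq hb (s := (k : ℝ))
      (by have : (0 : ℝ) ≤ k := Nat.cast_nonneg k
          linarith)).const_mul a
    simpa only [eval_monomial, Real.rpow_natCast, mul_assoc] using h

lemma aux_int_s13 (u T : ℝ) (hT : 0 < T)
    (w : ℝ → ℝ) (hw : ∀ v, w v = Real.exp (-(v - u) ^ 2 / (2 * T))) (p : Polynomial ℝ) :
    IntegrableOn (fun v : ℝ => p.eval v * w v) (Set.Ioi 0) := by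
  have h := (aux_int0 (1 / (2 * T)) (by positivity) (p.comp (X + C u))).comp_sub_right u
  refine Integrable.integrableOn (h.congr (Filter.Eventually.of_forall fun v => ?_))
  simp only [eval_comp, eval_add, eval_X, eval_C, hw, sub_add_cancel]
  congr 2
  ring

lemma aux_orth (w : ℝ → ℝ)
    (hint : ∀ p : Polynomial ℝ, IntegrableOn (fun v : ℝ => p.eval v * w v) (Set.Ioi 0))
    (B : ℕ → Polynomial ℝ)
    (hdeg : ∀ n, (B n).natDegree = n)
    (hlead : ∀ n, 0 < (B n).leadingCoeff)
    (horth : ∀ m n, ∫ v in Set.Ioi (0 : ℝ), (B m).eval v * (B n).eval v * w v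
        = if m = n then 1 else 0) (n : ℕ) :
    ∀ k, k ≤ n → ∀ p : Polynomial ℝ, p.degree < k →
      ∫ v in Set.Ioi (0 : ℝ), p.eval v * (B n).eval v * w v = 0 := by
  intro k
  induction k with
  | zero =>
    intro _ p hp
    have : p = 0 := by
      ext m
      exact (degree_lt_iff_coeff_zero p 0).1 hp m (Nat.zero_le m)
    simp [this]
  | succ k ih =>
    intro hk p hp
    have hl : (B k).coeff k ≠ 0 := by
      have := hlead k
      rw [leadingCoeff, hdeg] at this
      exact this.ne'
    set a := p.coeff k / (B k).coeff k with ha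
    have hq : (p - C a * B k).degree < k := by
      rw [degree_lt_iff_coeff_zero]
      intro m hm
      rw [coeff_sub, coeff_C_mul]
      rcases hm.eq_or_lt with rfl | h
      · rw [ha]; field_simp; ring
      · rw [(degree_lt_iff_coeff_zero p (k+1)).1 hp m h,
          coeff_eq_zero_of_natDegree_lt (by rw [hdeg]; exact h)]
        ring
    have h1 := ih (by omega) _ hq
    have h2 := horth k n
    rw [if_neg (by omega)] at h2
    have i1 := hint ((p - C a * B k) * B n)
    have i2 := (hint (B k * B n)).const_mul a
    simp only [eval_mul] at i1 i2
    have e : ∀ v, p.eval v * (B n).eval v * w v =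
        (p - C a * B k).eval v * (B n).eval v * w v
        + a * ((B k).eval v * (B n).eval v * w v) := by
      intro v
      simp only [eval_sub, eval_mul, eval_C]
      ring
    simp only [e]
    rw [integral_add i1 i2, integral_const_mul, h1, h2]
    ring


/-- For every n, ∫₀^∞ v·B_n'(v)·B_n(v)·w(v) dv = n. -/
theorem halfspace_hermite_deriv_self_moment
    (u T : ℝ) (hT : 0 < T)
    (w : ℝ → ℝ) (hw : ∀ v, w v = Real.exp (-(v - u) ^ 2 / (2 * T)))
    (B : ℕ → Polynomial ℝ)
    (hdeg : ∀ n, (B n).natDegree = n)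
    (hlead : ∀ n, 0 < (B n).leadingCoeff)
    (horth : ∀ m n, ∫ v in Set.Ioi (0 : ℝ), (B m).eval v * (B n).eval v * w v
        = if m = n then 1 else 0)
    (α : ℕ → ℝ)
    (hα : ∀ n, α n = ∫ v in Set.Ioi (0 : ℝ), v * (B n).eval v ^ 2 * w v)
    (c : ℕ → ℝ) (hc0 : c 0 = 0)
    (hc : ∀ n, c (n + 1) = ∫ v in Set.Ioi (0 : ℝ), v * (B n).eval v * (B (n + 1)).eval v * w v)
    (β : ℕ → ℝ) (hβ : ∀ n, β n = c n ^ 2)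
    (hrec : ∀ n, ∀ v : ℝ, c (n + 1) * (B (n + 1)).eval v
        = (v - α n) * (B n).eval v - c n * (B (n - 1)).eval v)
    (hcpos : ∀ n, 1 ≤ n → 0 < c n) :
    ∀ n : ℕ, ∫ v in Set.Ioi (0 : ℝ),
      v * (Polynomial.derivative (B n)).eval v * (B n).eval v * w v = n := by
  intro n
  have hint := aux_int_s13 u T hT w hw
  have hq : (X * derivative (B n) - C (n : ℝ) * B n).degree < (n : WithBot ℕ) := by
    rw [degree_lt_iff_coeff_zero]
    intro m hm
    rw [coeff_sub, coeff_C_mul]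
    have hX : (X * derivative (B n)).coeff m = m * (B n).coeff m := by
      cases m with
      | zero => simp
      | succ m => rw [coeff_X_mul, coeff_derivative]; push_cast; ring
    rw [hX]
    rcases hm.eq_or_lt with rfl | h
    · ring
    · rw [coeff_eq_zero_of_natDegree_lt (by rw [hdeg]; exact h)]
      ring
  have h1 := aux_orth w hint B hdeg hlead horth n n le_rfl _ hq
  have h2 := horth n n
  rw [if_pos rfl] at h2
  have i1 := hint ((X * derivative (B n) - C (n : ℝ) * B n) * B n)
  have i2 := (hint (B n * B n)).const_mul (n : ℝ)
  simp only [eval_mul] at i1 i2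
  have e : ∀ v, v * (derivative (B n)).eval v * (B n).eval v * w v =
      (X * derivative (B n) - C (n : ℝ) * B n).eval v * (B n).eval v * w v
      + n * ((B n).eval v * (B n).eval v * w v) := by
    intro v
    simp only [eval_sub, eval_mul, eval_C, eval_X]
    ring
  simp only [e]
  rw [integral_add i1 i2, integral_const_mul, h1, h2]
  ring
end

section
/- For every n ≥ 0, α_0 + α_1 + ⋯ + α_n = c_{n+1}·∫₀^∞ v·B_{n+1}'(v)·B_n(v)·w(v) dv, where B_{n+1}' denotes the derivative of the polynomial B_{n+1}. -/
open MeasureTheory Polynomial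

lemma hh_integrable_s15 (b : ℝ) (hb : 0 < b) (p : Polynomial ℝ) :
    Integrable (fun x : ℝ => p.eval x * Real.exp (-b * x ^ 2)) := by
  induction p using Polynomial.induction_on' with
  | add p q hp hq =>
    simp only [eval_add, add_mul]
    exact hp.add hq
  | monomial n a =>
    have h := (integrable_rpow_mul_exp_neg_mul_sq hb (s := (n : ℝ))
      (by have : (0:ℝ) ≤ n := Nat.cast_nonneg n
          linarith)).const_mul a
    simp only [Real.rpow_natCast] at h
    simpa [eval_monomial, mul_assoc] using h

lemma hh_integrable_w (u T : ℝ) (hT : 0 < T)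
    (w : ℝ → ℝ) (hw : ∀ v, w v = Real.exp (-(v - u) ^ 2 / (2 * T))) (p : Polynomial ℝ) :
    Integrable (fun v => p.eval v * w v) (volume.restrict (Set.Ioi (0 : ℝ))) := by
  have h := (hh_integrable_s15 (1 / (2 * T)) (by positivity) (p.comp (X + C u))).comp_sub_right u
  refine (h.congr (Filter.Eventually.of_forall fun v => ?_)).restrict
  simp only [eval_comp, eval_add, eval_X, eval_C, sub_add_cancel, hw]
  congr 2
  ring

/-- Algebraic core. -/
lemma hh_core (L : Polynomial ℝ →ₗ[ℝ] ℝ) (B : ℕ → Polynomial ℝ)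
    (hdeg : ∀ n, (B n).natDegree = n) (hlead : ∀ n, 0 < (B n).leadingCoeff)
    (horth : ∀ m n, L (B m * B n) = if m = n then 1 else 0)
    (α c : ℕ → ℝ) (hc0 : c 0 = 0)
    (hα : ∀ n, α n = L (X * B n ^ 2))
    (hrec : ∀ n, C (c (n + 1)) * B (n + 1) = (X - C (α n)) * B n - C (c n) * B (n - 1)) (n : ℕ) :
    ∑ k ∈ Finset.range (n + 1), α k = c (n + 1) * L (X * derivative (B (n + 1)) * B n) := by
  have hC : ∀ (a : ℝ) p, L (C a * p) = a * L p := fun a p => by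
    rw [← smul_eq_C_mul, map_smul, smul_eq_mul]
  have hX : ∀ k n, k < n → L (X ^ k * B n) = 0 := by
    intro k
    induction k with
    | zero =>
      intro n hn
      have h0 := eq_C_of_natDegree_eq_zero (hdeg 0)
      have h1 := horth 0 n
      have h2 := hlead 0
      rw [leadingCoeff, hdeg] at h2
      rw [h0, hC, if_neg (by omega)] at h1
      simpa [h2.ne'] using h1
    | succ k ih =>
      intro n hn
      have e : X ^ (k + 1) * B n = C (c (n + 1)) * (X ^ k * B (n + 1))
          + C (α n) * (X ^ k * B n) + C (c n) * (X ^ k * B (n - 1)) := by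
        linear_combination (-X ^ k) * hrec n
      rw [e, map_add, map_add, hC, hC, hC, ih _ (by omega), ih _ (by omega), ih _ (by omega)]
      simp
  have hlow : ∀ q : Polynomial ℝ, ∀ n, q.natDegree < n → L (q * B n) = 0 := by
    intro q n hq
    rw [q.as_sum_range_C_mul_X_pow, Finset.sum_mul, map_sum]
    refine Finset.sum_eq_zero fun i hi => ?_
    rw [mul_assoc, hC, hX _ _ (by have := Finset.mem_range.1 hi; omega), mul_zero]
  have hder : ∀ m n, m < n → L (X * derivative (B m) * B n) = 0 := by
    intro m n hmn
    rcases Nat.eq_zero_or_pos m with rfl | hm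
    · rw [eq_C_of_natDegree_eq_zero (hdeg 0)]; simp
    · apply hlow
      have h1 := natDegree_mul_le (p := X) (q := derivative (B m))
      have h2 := natDegree_derivative_le (B m)
      rw [hdeg] at h2
      rw [natDegree_X] at h1
      omega
  have key : ∀ n, c (n + 1) * L (X * derivative (B (n + 1)) * B n)
      = α n + c n * L (X * derivative (B n) * B (n - 1)) := by
    intro n
    have hd := congrArg derivative (hrec n)
    simp only [derivative_mul, derivative_sub, derivative_C, derivative_X] at hd
    have e : C (c (n + 1)) * (X * derivative (B (n + 1)) * B n)
        = X * B n ^ 2 + C (c (n + 1)) * (X * derivative (B n) * B (n + 1))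
          + C (c n) * (X * derivative (B n) * B (n - 1))
          - C (c n) * (X * derivative (B (n - 1)) * B n) := by
      linear_combination (X * B n) * hd - (X * derivative (B n)) * hrec n
    have h3 : c n * L (X * derivative (B (n - 1)) * B n) = 0 := by
      rcases Nat.eq_zero_or_pos n with rfl | hn
      · rw [hc0, zero_mul]
      · rw [hder _ _ (by omega), mul_zero]
    rw [← hC, e, map_sub, map_add, map_add, hC, hC, hC, h3, hder _ _ (Nat.lt_succ_self n), ← hα]
    ring
  induction n with
  | zero => rw [key]; simp [hc0]
  | succ n ih => rw [Finset.sum_range_succ, ih, key (n + 1)]; simp [add_comm]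

/-- For every n, α_0 + ⋯ + α_n = c_{n+1}·∫₀^∞ v·B_{n+1}'(v)·B_n(v)·w(v) dv. -/
theorem halfspace_hermite_alpha_sum
    (u T : ℝ) (hT : 0 < T)
    (w : ℝ → ℝ) (hw : ∀ v, w v = Real.exp (-(v - u) ^ 2 / (2 * T)))
    (B : ℕ → Polynomial ℝ)
    (hdeg : ∀ n, (B n).natDegree = n)
    (hlead : ∀ n, 0 < (B n).leadingCoeff)
    (horth : ∀ m n, ∫ v in Set.Ioi (0 : ℝ), (B m).eval v * (B n).eval v * w v
        = if m = n then 1 else 0)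
    (α : ℕ → ℝ)
    (hα : ∀ n, α n = ∫ v in Set.Ioi (0 : ℝ), v * (B n).eval v ^ 2 * w v)
    (c : ℕ → ℝ) (hc0 : c 0 = 0)
    (hc : ∀ n, c (n + 1) = ∫ v in Set.Ioi (0 : ℝ), v * (B n).eval v * (B (n + 1)).eval v * w v)
    (β : ℕ → ℝ) (hβ : ∀ n, β n = c n ^ 2)
    (hrec : ∀ n, ∀ v : ℝ, c (n + 1) * (B (n + 1)).eval v
        = (v - α n) * (B n).eval v - c n * (B (n - 1)).eval v)
    (hcpos : ∀ n, 1 ≤ n → 0 < c n) :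
    ∀ n : ℕ, ∑ k ∈ Finset.range (n + 1), α k
      = c (n + 1) * ∫ v in Set.Ioi (0 : ℝ),
          v * (Polynomial.derivative (B (n + 1))).eval v * (B n).eval v * w v := by
  let L : Polynomial ℝ →ₗ[ℝ] ℝ :=
    { toFun := fun p => ∫ v in Set.Ioi (0 : ℝ), p.eval v * w v
      map_add' := fun p q => by
        simp only [eval_add, add_mul]
        exact integral_add (hh_integrable_w u T hT w hw p) (hh_integrable_w u T hT w hw q)
      map_smul' := fun a p => by
        simp only [eval_smul, smul_eq_mul, mul_assoc, RingHom.id_apply]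
        exact integral_const_mul _ _ }
  have hL : ∀ p, L p = ∫ v in Set.Ioi (0 : ℝ), p.eval v * w v := fun _ => rfl
  intro n
  have h := hh_core L B hdeg hlead (fun m n => by rw [hL, ← horth m n]; simp only [eval_mul]) α c hc0
    (fun n => by rw [hL, hα]; simp only [eval_mul, eval_pow, eval_X])
    (fun n => Polynomial.funext fun v => by simpa using hrec n v) n
  rw [h, hL]
  simp only [eval_mul, eval_X]
end
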